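/- arXiv:1706.08955 — 2 statements merged into one kernel-verified Lean document; each statement's English description precedes it below -/
import Mathlib

section
/- Let T be one of the three lattices U(2) ⊕ E₈(−2), U ⊕ E₈(−2), or U(2) ⊕ D₄(−1), and let L := U^{⊕3} ⊕ E₈(−1)^{⊕2} ⊕ ⟨−2⟩. Then any two primitive isometric embeddings of T into L are conjugate under the isometry group of L: if f₁, f₂ : T → L are injective ℤ-linear maps preserving the bilinear forms whose images are primitive sublattices, then there exists an isometry g of L with g ∘ f₁ = f₂. -/
open Matrix

/-- The bilinear form of the lattice `ℤⁿ` with Gram matrix `G`. -/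
def bform {n : ℕ} (G : Matrix (Fin n) (Fin n) ℤ) (v w : Fin n → ℤ) : ℤ :=
  v ⬝ᵥ G.mulVec w

/-- Gram matrix of the hyperbolic plane `U`. -/
def UMat : Matrix (Fin 2) (Fin 2) ℤ := !![0, 1; 1, 0]

/-- Gram matrix of the root lattice `E₈` (the `E₈` Cartan matrix). -/
def E8Mat : Matrix (Fin 8) (Fin 8) ℤ := CartanMatrix.E₈

/-- Gram matrix of the root lattice `D₄` (the `D₄` Cartan matrix). -/
def D4Mat : Matrix (Fin 4) (Fin 4) ℤ :=
  !![ 2, -1,  0,  0;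
     -1,  2, -1, -1;
      0, -1,  2,  0;
      0, -1,  0,  2]

/-- Orthogonal direct sum of two Gram matrices. -/
def dsum {m n : ℕ} (G : Matrix (Fin m) (Fin m) ℤ) (H : Matrix (Fin n) (Fin n) ℤ) :
    Matrix (Fin (m + n)) (Fin (m + n)) ℤ :=
  Matrix.reindex finSumFinEquiv finSumFinEquiv (Matrix.fromBlocks G 0 0 H)

/-- Gram matrix of `L = U³ ⊕ E₈(-1)² ⊕ ⟨-2⟩`, the Beauville–Bogomolov–Fujiki
lattice of manifolds of `K3^[2]`-type. -/
def LMat : Matrix (Fin 23) (Fin 23) ℤ :=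
  dsum (dsum (dsum UMat (dsum UMat UMat)) (dsum (-E8Mat) (-E8Mat))) !![-2]

/-- Gram matrix of `U(2) ⊕ E₈(-2)`. -/
def T1Mat : Matrix (Fin 10) (Fin 10) ℤ := dsum ((2 : ℤ) • UMat) ((-2 : ℤ) • E8Mat)

/-- Gram matrix of `U ⊕ E₈(-2)`. -/
def T2Mat : Matrix (Fin 10) (Fin 10) ℤ := dsum UMat ((-2 : ℤ) • E8Mat)

/-- Gram matrix of `U(2) ⊕ D₄(-1)`. -/
def T3Mat : Matrix (Fin 6) (Fin 6) ℤ := dsum ((2 : ℤ) • UMat) (-D4Mat)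

/-- `F` (viewed as the linear map `v ↦ F *ᵥ v` from `ℤᵐ` to `ℤᴺ`) is a primitive
isometric embedding of the lattice with Gram matrix `G` into the lattice with
Gram matrix `H`: it is injective, preserves the bilinear forms, and its image is
a primitive sublattice (the quotient by the image is torsion-free). -/
def IsPrimitiveIsometricEmb {m N : ℕ} (G : Matrix (Fin m) (Fin m) ℤ)
    (H : Matrix (Fin N) (Fin N) ℤ) (F : Matrix (Fin N) (Fin m) ℤ) : Prop :=
  Function.Injective F.mulVec ∧
  (∀ v w : Fin m → ℤ, bform H (F *ᵥ v) (F *ᵥ w) = bform G v w) ∧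
  (∀ (x : Fin N → ℤ) (c : ℤ), c ≠ 0 → (∃ v, c • x = F *ᵥ v) → ∃ v, x = F *ᵥ v)

/-- Any two primitive isometric embeddings of the lattice with Gram matrix `GT`
into `L = U³ ⊕ E₈(-1)² ⊕ ⟨-2⟩` are conjugate under an isometry of `L`. -/
def EmbeddingsConjugate {m : ℕ} (GT : Matrix (Fin m) (Fin m) ℤ) : Prop :=
  ∀ F₁ F₂ : Matrix (Fin 23) (Fin m) ℤ,
    IsPrimitiveIsometricEmb GT LMat F₁ → IsPrimitiveIsometricEmb GT LMat F₂ →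
    ∃ P : Matrix (Fin 23) (Fin 23) ℤ,
      (∃ Q, P * Q = 1 ∧ Q * P = 1) ∧
      (∀ v w : Fin 23 → ℤ, bform LMat (P *ᵥ v) (P *ᵥ w) = bform LMat v w) ∧
      P * F₁ = F₂


section Eichler
variable {X : Type*} [AddCommGroup X] (B : LinearMap.BilinForm ℤ X)

/-- Eichler transvection as a linear map. -/
def eichLin (e a : X) (q : ℤ) : X →ₗ[ℤ] X where
  toFun x := x - B a x • e + B e x • a - (q * B e x) • e
  map_add' x y := by simp only [map_add]; module
  map_smul' c x := by simp only [map_smul, smul_eq_mul, RingHom.id_apply]; module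

theorem eichLin_apply (e a : X) (q : ℤ) (x : X) :
    eichLin B e a q x = x - B a x • e + B e x • a - (q * B e x) • e := rfl

theorem eichLin_inv (e a : X) (q : ℤ) (he : B e e = 0) (hae : B a e = 0) (hea : B e a = 0)
    (hq : B a a = 2 * q) (x : X) : eichLin B e (-a) q (eichLin B e a q x) = x := by
  simp only [eichLin_apply, map_add, map_sub, map_smul, map_neg, LinearMap.neg_apply,
    he, hae, hea, hq]
  module

/-- Isometries of `X` fixing `S` pointwise, as a relation on vectors. -/
def Orb (S : Set X) (v w : X) : Prop :=
  ∃ g : X ≃ₗ[ℤ] X, (∀ x y, B (g x) (g y) = B x y) ∧ (∀ s ∈ S, g s = s) ∧ g v = w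

variable {B}

theorem Orb.refl (S : Set X) (v : X) : Orb B S v v :=
  ⟨LinearEquiv.refl ℤ X, fun _ _ => rfl, fun _ _ => rfl, rfl⟩

theorem Orb.trans {S : Set X} {u v w : X} (h : Orb B S u v) (k : Orb B S v w) : Orb B S u w := by
  obtain ⟨g, g1, g2, g3⟩ := h
  obtain ⟨l, l1, l2, l3⟩ := k
  refine ⟨g.trans l, fun x y => ?_, fun s hs => ?_, ?_⟩
  · simp [l1, g1]
  · simp [g2 s hs, l2 s hs]
  · simp [g3, l3]

theorem Orb.symm {S : Set X} {u v : X} (h : Orb B S u v) : Orb B S v u := by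
  obtain ⟨g, g1, g2, g3⟩ := h
  refine ⟨g.symm, fun x y => ?_, fun s hs => ?_, ?_⟩
  · rw [← g1]; simp
  · rw [LinearEquiv.symm_apply_eq, g2 s hs]
  · rw [LinearEquiv.symm_apply_eq, g3]

theorem orb_eich (hs : ∀ x y, B x y = B y x) {S : Set X} (e a : X) (q : ℤ) (he : B e e = 0)
    (hae : B a e = 0) (hq : B a a = 2 * q) (hSe : ∀ s ∈ S, B e s = 0) (hSa : ∀ s ∈ S, B a s = 0)
    (v : X) : Orb B S v (v - B a v • e + B e v • a - (q * B e v) • e) := by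
  have hea : B e a = 0 := by rw [hs, hae]
  have i1 := eichLin_inv B e a q he hae hea hq
  have i2 := eichLin_inv B e (-a) q he (by simp [hae]) (by simp [hea]) (by simp [hq])
  rw [neg_neg] at i2
  refine ⟨LinearEquiv.ofLinearMap (eichLin B e a q) (eichLin B e (-a) q)
    (LinearMap.ext i2) (LinearMap.ext i1), fun x y => ?_, fun s h => ?_, rfl⟩
  · simp only [LinearEquiv.coe_ofLinearMap, eichLin_apply, map_add, map_sub, map_smul,
      LinearMap.add_apply, LinearMap.sub_apply, LinearMap.smul_apply, smul_eq_mul, he, hae, hea, hq]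
    rw [hs x a, hs x e]
    ring
  · simp [eichLin_apply, hSe s h, hSa s h]

/-- Data of two orthogonal hyperbolic planes, orthogonal to `S`. -/
structure Hyp (B : LinearMap.BilinForm ℤ X) (S : Set X) (e f e1 f1 : X) : Prop where
  ee : B e e = 0
  ff : B f f = 0
  ef : B e f = 1
  e1e1 : B e1 e1 = 0
  f1f1 : B f1 f1 = 0
  e1f1 : B e1 f1 = 1
  ee1 : B e e1 = 0
  ef1 : B e f1 = 0
  fe1 : B f e1 = 0
  ff1 : B f f1 = 0
  Se : ∀ s ∈ S, B e s = 0
  Sf : ∀ s ∈ S, B f s = 0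
  Se1 : ∀ s ∈ S, B e1 s = 0
  Sf1 : ∀ s ∈ S, B f1 s = 0

/-- Swap of `e1` and `f1`. -/
theorem Hyp.swap {S : Set X} {e f e1 f1 : X} (hs : ∀ x y, B x y = B y x)
    (h : Hyp B S e f e1 f1) : Hyp B S e f f1 e1 :=
  { ee := h.ee, ff := h.ff, ef := h.ef, e1e1 := h.f1f1, f1f1 := h.e1e1, e1f1 := by rw [hs, h.e1f1],
    ee1 := h.ef1, ef1 := h.ee1, fe1 := h.ff1, ff1 := h.fe1, Se := h.Se, Sf := h.Sf,
    Se1 := h.Sf1, Sf1 := h.Se1 }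

/-- elementary move: change the `f`-value by a multiple of the `e1`-value -/
theorem move1 (hs : ∀ x y, B x y = B y x) {S : Set X} {e f e1 f1 : X} (h : Hyp B S e f e1 f1)
    (v : X) (k : ℤ) : ∃ w, Orb B S v w ∧ B f w = B f v - k * B e1 v ∧ B e w = B e v ∧
      B e1 w = B e1 v ∧ B f1 w = B f1 v + k * B e v := by
  obtain ⟨ee, ff, ef, e1e1, f1f1, e1f1, ee1, ef1, fe1, ff1, Se, Sf, Se1, Sf1⟩ := h
  refine ⟨_, orb_eich hs e (k • e1) 0 ee (by simp [hs e1 e, ee1]) (by simp [e1e1]) Se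
    (fun s h => by simp [Se1 s h]) v, ?_, ?_, ?_, ?_⟩
  · simp [hs f e, ef, fe1]
  · simp [ee, ee1]
  · simp [hs e1 e, ee1, e1e1]
  · simp [hs f1 e, hs f1 e1, ef1, e1f1, mul_comm]

/-- elementary move: change the `e1`-value by a multiple of the `f`-value -/
theorem move2 (hs : ∀ x y, B x y = B y x) {S : Set X} {e f e1 f1 : X} (h : Hyp B S e f e1 f1)
    (v : X) (k : ℤ) : ∃ w, Orb B S v w ∧ B e1 w = B e1 v + k * B f v ∧ B f w = B f v ∧
      B f1 w = B f1 v ∧ B e w = B e v - k * B f1 v := by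
  obtain ⟨ee, ff, ef, e1e1, f1f1, e1f1, ee1, ef1, fe1, ff1, Se, Sf, Se1, Sf1⟩ := h
  refine ⟨_, orb_eich hs f (k • f1) 0 ff (by simp [hs f1 f, ff1]) (by simp [f1f1]) Sf
    (fun s h => by simp [Sf1 s h]) v, ?_, ?_, ?_, ?_⟩
  · simp [hs e1 f, e1f1, fe1, mul_comm]
  · simp [ff, ff1]
  · simp [hs f1 f, ff1, f1f1]
  · simp [ef, ef1]

theorem claimA (hs : ∀ x y, B x y = B y x) {S : Set X} {e f e1 f1 : X} (h : Hyp B S e f e1 f1)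
    (v : X) (al : ℤ) (hmin : ∀ w, Orb B S v w → B f w ≠ 0 → al ≠ 0 ∧ |al| ≤ |B f w|)
    (w : X) (hw : Orb B S v w) (hal : B f w = al) : al ∣ B e1 w := by
  by_contra hnd
  have hr : B e1 w % al ≠ 0 := fun h0 => hnd (Int.dvd_of_emod_eq_zero h0)
  obtain ⟨w1, o1, a1, b1, -, -⟩ := move2 hs h w (-(B e1 w / al))
  have hr1 : B e1 w1 = B e1 w % al := by
    rw [a1, hal, Int.emod_def]; ring
  set r := B e1 w % al with hrdef
  obtain ⟨w2, o2, a2, -, -, -⟩ := move1 hs h w1 ((al - r) / r)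
  have hv : B f w2 = (al - r) % r + r := by
    rw [a2, hr1, b1, hal, Int.emod_def]; ring
  by_cases h0 : al = 0
  · obtain ⟨w3, o3, a3, -, -, -⟩ := move1 hs h w1 1
    have := (hmin w3 ((hw.trans o1).trans o3) (by rw [a3, b1, hal, hr1, h0]; simpa using hr)).1
    exact this h0
  · have hrpos : 0 < r := lt_of_le_of_ne (Int.emod_nonneg _ h0) (Ne.symm hr)
    have hrlt : r < |al| := Int.emod_lt_abs _ h0
    obtain ⟨w3, o3, a3, -, -, -⟩ := move1 hs h w1 ((al - 1) / r)
    have hv3 : B f w3 = (al - 1) % r + 1 := by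
      rw [a3, hr1, b1, hal, Int.emod_def]; ring
    have p1 := Int.emod_nonneg (al - 1) hrpos.ne'
    have p2 := Int.emod_lt_of_pos (al - 1) hrpos
    have := (hmin w3 ((hw.trans o1).trans o3) (by omega)).2
    rw [hv3, abs_of_pos (by omega : (0:ℤ) < (al - 1) % r + 1)] at this
    omega

theorem to_one (hs : ∀ x y, B x y = B y x) (hev : ∀ x, ∃ q, B x x = 2 * q)
    {S : Set X} {e f e1 f1 : X} (h : Hyp B S e f e1 f1)
    (v x : X) (hx : ∀ s ∈ S, B x s = 0) (hvx : B x v = 1) : ∃ w, Orb B S v w ∧ B f w = 1 := by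
  -- a minimal element
  obtain ⟨w, hw, hmin⟩ : ∃ w, Orb B S v w ∧
      ∀ w', Orb B S v w' → B f w' ≠ 0 → B f w ≠ 0 ∧ |B f w| ≤ |B f w'| := by
    by_cases hne : ∃ n : ℕ, ∃ w, Orb B S v w ∧ B f w ≠ 0 ∧ (B f w).natAbs = n
    · classical
      obtain ⟨w, h1, h2, h3⟩ := Nat.find_spec hne
      refine ⟨w, h1, fun w' o hn => ⟨h2, ?_⟩⟩
      have := Nat.find_min' hne ⟨w', o, hn, rfl⟩
      rw [← h3] at this
      rw [Int.abs_eq_natAbs, Int.abs_eq_natAbs]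
      exact_mod_cast this
    · exact ⟨v, Orb.refl S v, fun w' o hn => absurd ⟨_, w', o, hn, rfl⟩ hne⟩
  set al := B f w with hal
  -- kill the second plane
  have d1 : al ∣ B e1 w := claimA hs h v al hmin w hw rfl
  obtain ⟨k, hk⟩ := d1
  obtain ⟨w1, o1, a1, b1, c1, -⟩ := move2 hs h w (-k)
  have e1w1 : B e1 w1 = 0 := by rw [a1, hk]; ring
  have ow1 := hw.trans o1
  obtain ⟨k', hk'⟩ := claimA hs (h.swap hs) v al hmin w1 ow1 b1
  obtain ⟨w2, o2, a2, b2, c2, -⟩ := move2 hs (h.swap hs) w1 (-k')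
  have f1w2 : B f1 w2 = 0 := by rw [a2, b1, hk']; ring
  have e1w2 : B e1 w2 = 0 := by rw [c2, e1w1]
  have fw2 : B f w2 = al := by rw [b2, b1]
  have ow2 := ow1.trans o2
  have dE : al ∣ B e w2 := by
    obtain ⟨w3, o3, a3, -, -, d3⟩ := move1 hs h w2 1
    have := claimA hs (h.swap hs) v al hmin w3 (ow2.trans o3) (by rw [a3, e1w2, fw2]; ring)
    rw [d3, f1w2] at this
    simpa using this
  have dY : ∀ a, B a e = 0 → B a f = 0 → B a e1 = 0 → B a f1 = 0 → (∀ s ∈ S, B a s = 0) →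
      al ∣ B a w2 := by
    intro a ae af ae1 af1 aS
    obtain ⟨q, hq⟩ := hev a
    have o3 := orb_eich hs f1 a q h.f1f1 af1 hq h.Sf1 aS w2
    have := claimA hs h v al hmin _ (ow2.trans o3)
      (by simp [h.ff1, f1w2, fw2])
    simpa [hs e1 a, ae1, h.e1f1, f1w2, e1w2] using this
  have hunit : al ∣ 1 := by
    obtain ⟨g, g1, g2, g3⟩ := ow2
    have hgx : B (g x) w2 = 1 := by rw [← g3, g1, hvx]
    have hgS : ∀ s ∈ S, B (g x) s = 0 := fun s hsS => by
      conv_lhs => rw [← g2 s hsS]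
      rw [g1, hx s hsS]
    generalize g x = z at hgx hgS
    have := dY (z - B z f • e - B z e • f - B z f1 • e1 - B z e1 • f1)
      (by simp [h.ee, hs f e, h.ef, hs e1 e, hs f1 e, h.ee1, h.ef1])
      (by simp [h.ff, h.ef, hs e1 f, hs f1 f, h.fe1, h.ff1])
      (by simp [h.ee1, h.fe1, h.e1e1, hs f1 e1, h.e1f1])
      (by simp [h.ef1, h.ff1, h.e1f1, h.f1f1])
      (fun s hsS => by simp [hgS s hsS, h.Se s hsS, h.Sf s hsS, h.Se1 s hsS, h.Sf1 s hsS])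
    simp only [map_sub, map_smul, LinearMap.sub_apply, LinearMap.smul_apply, smul_eq_mul, hgx,
      fw2, e1w2, f1w2] at this
    have t1 : al ∣ B z f * B e w2 := dE.mul_left _
    have t2 : al ∣ B z e * al := dvd_mul_left _ _
    have := (this.add t1).add t2
    ring_nf at this
    exact this
  obtain ⟨m, hm⟩ := hunit
  obtain ⟨w3, o3, a3, b3, -, -⟩ := move2 hs h w2 m
  have e1w3 : B e1 w3 = 1 := by rw [a3, e1w2, fw2, hm]; ring
  obtain ⟨w4, o4, a4, -, -, -⟩ := move1 hs h w3 (al - 1)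
  refine ⟨w4, (ow2.trans o3).trans o4, ?_⟩
  rw [a4, b3, fw2, e1w3]; ring

/-- Relative Eichler criterion. -/
theorem eichler (hs : ∀ x y, B x y = B y x) (hev : ∀ x, ∃ q, B x x = 2 * q)
    {S : Set X} {e f e1 f1 : X} (h : Hyp B S e f e1 f1)
    (v x v' x' : X) (hx : ∀ s ∈ S, B x s = 0) (hvx : B x v = 1)
    (hx' : ∀ s ∈ S, B x' s = 0) (hvx' : B x' v' = 1)
    (hvv : B v v = B v' v') (hS : ∀ s ∈ S, B v s = B v' s) : Orb B S v v' := by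
  obtain ⟨w, ow, fw⟩ := to_one hs hev h v x hx hvx
  obtain ⟨w', ow', fw'⟩ := to_one hs hev h v' x' hx' hvx'
  refine (ow.trans ?_).trans ow'.symm
  have nw : B w w = B w' w' := by
    obtain ⟨g, g1, -, g3⟩ := ow
    obtain ⟨l, l1, -, l3⟩ := ow'
    rw [← g3, ← l3, g1, l1, hvv]
  have sw : ∀ s ∈ S, B (w' - w) s = 0 := by
    intro s hsS
    obtain ⟨g, g1, g2, g3⟩ := ow
    obtain ⟨l, l1, l2, l3⟩ := ow'
    have i1 : B w s = B v s := by rw [← g3, ← g1 v s, g2 s hsS]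
    have i2 : B w' s = B v' s := by rw [← l3, ← l1 v' s, l2 s hsS]
    rw [map_sub, LinearMap.sub_apply, i1, i2, hS s hsS, sub_self]
  obtain ⟨q, hq⟩ := hev (w' - w)
  have o := orb_eich hs f (w' - w) q h.ff (by simp [hs w' f, hs w f, fw, fw']) hq h.Sf sw w
  convert o using 1
  have hc : - B (w' - w) w - q = 0 := by
    simp only [map_sub, LinearMap.sub_apply] at hq ⊢
    rw [hs w w'] at hq
    linarith
  rw [fw]
  have : w - B (w' - w) w • f + (1:ℤ) • (w' - w) - (q * 1) • f
      = w' + (- B (w' - w) w - q) • f := by module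
  rw [this, hc]; simp

/-- Moving a tuple of vectors step by step (from the last index down). -/
theorem chain (hs : ∀ x y, B x y = B y x) (hev : ∀ x, ∃ q, B x x = 2 * q)
    {e f e1 f1 : X} {m : ℕ} (r a xr xa : Fin m → X)
    (h : Hyp B {s | ∃ i : Fin m, 0 < (i : ℕ) ∧ s = r i} e f e1 f1)
    (hra : ∀ i j, B (a i) (a j) = B (r i) (r j))
    (hxr : ∀ i j, B (xr i) (r j) = if i = j then 1 else 0)
    (hxa : ∀ i j, B (xa i) (a j) = if i = j then 1 else 0) :
    ∃ g : X ≃ₗ[ℤ] X, (∀ x y, B (g x) (g y) = B x y) ∧ ∀ i, g (a i) = r i := by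
  suffices H : ∀ k ≤ m, ∃ g : X ≃ₗ[ℤ] X, (∀ x y, B (g x) (g y) = B x y) ∧
      ∀ i : Fin m, m ≤ i + k → g (a i) = r i by
    obtain ⟨g, g1, g2⟩ := H m le_rfl
    exact ⟨g, g1, fun i => g2 i (by omega)⟩
  intro k
  induction k with
  | zero => exact fun _ => ⟨LinearEquiv.refl ℤ X, fun _ _ => rfl, fun i hi => by omega⟩
  | succ k ih =>
    intro hk
    obtain ⟨g, g1, g2⟩ := ih (by omega)
    let j : Fin m := ⟨m - (k + 1), by omega⟩
    have hj : (j : ℕ) + (k + 1) = m := by simp only [j]; omega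
    let S : Set X := {s | ∃ i : Fin m, (j : ℕ) < i ∧ s = r i}
    have hsub : ∀ s ∈ S, s ∈ {s | ∃ i : Fin m, 0 < (i : ℕ) ∧ s = r i} := by
      rintro s ⟨i, hi, rfl⟩
      exact ⟨i, by omega, rfl⟩
    have hS : Hyp B S e f e1 f1 :=
      { h with
        Se := fun s q => h.Se s (hsub s q)
        Sf := fun s q => h.Sf s (hsub s q)
        Se1 := fun s q => h.Se1 s (hsub s q)
        Sf1 := fun s q => h.Sf1 s (hsub s q) }
    have ga : ∀ i : Fin m, (j : ℕ) < i → g (a i) = r i := fun i hi => g2 i (by omega)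
    obtain ⟨l, l1, l2, l3⟩ := eichler hs hev hS (g (a j)) (g (xa j)) (r j) (xr j)
      (by
        rintro s ⟨i, hi, rfl⟩
        rw [← ga i hi, g1, hxa, if_neg]
        rintro rfl; omega)
      (by rw [g1, hxa, if_pos rfl])
      (by
        rintro s ⟨i, hi, rfl⟩
        rw [hxr, if_neg]
        rintro rfl; omega)
      (by rw [hxr, if_pos rfl])
      (by rw [g1, hra])
      (by
        rintro s ⟨i, hi, rfl⟩
        rw [← hra, ← g1 (a j) (a i), ga i hi])
    refine ⟨g.trans l, fun x y => by simp [l1, g1], fun i hi => ?_⟩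
    by_cases hij : i = j
    · subst hij; simpa using l3
    · have : (j : ℕ) < i := by
        have : (i : ℕ) ≠ j := fun q => hij (Fin.ext q)
        omega
      simp only [LinearEquiv.trans_apply, ga i this]
      exact l2 _ ⟨i, this, rfl⟩

end Eichler

/-- Inverse of the `E₈` Cartan matrix. -/
def E8Inv : Matrix (Fin 8) (Fin 8) ℤ :=
  !![4, 5, 7, 10, 8, 6, 4, 2;
     5, 8, 10, 15, 12, 9, 6, 3;
     7, 10, 14, 20, 16, 12, 8, 4;
     10, 15, 20, 30, 24, 18, 12, 6;
     8, 12, 16, 24, 20, 15, 10, 5;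
     6, 9, 12, 18, 15, 12, 8, 4;
     4, 6, 8, 12, 10, 8, 6, 3;
     2, 3, 4, 6, 5, 4, 3, 2]

/-- Integral matrix which is the inverse of `LMat` up to a factor 2 in the last coordinate. -/
def LInv : Matrix (Fin 23) (Fin 23) ℤ :=
  dsum (dsum (dsum UMat (dsum UMat UMat)) (dsum (-E8Inv) (-E8Inv))) !![-1]

/-- Upper triangular half of a Gram matrix. -/
def halfMat {n : ℕ} (G : Matrix (Fin n) (Fin n) ℤ) : Matrix (Fin n) (Fin n) ℤ :=
  Matrix.of fun i j => if i < j then G i j else if i = j then G i j / 2 else 0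

theorem LMat_symm : LMatᵀ = LMat := by decide +kernel

theorem LMat_half : halfMat LMat + (halfMat LMat)ᵀ = LMat := by decide +kernel

theorem LInv_mul : LInv * LMat = Matrix.diagonal (fun i : Fin 23 => if i = 22 then 2 else 1) := by
  decide +kernel

theorem bform_half {n : ℕ} (K : Matrix (Fin n) (Fin n) ℤ) (v : Fin n → ℤ) :
    bform (K + Kᵀ) v v = 2 * (v ⬝ᵥ K *ᵥ v) := by
  unfold bform
  rw [Matrix.add_mulVec, dotProduct_add, Matrix.mulVec_transpose,
    dotProduct_comm v (v ᵥ* K), ← Matrix.dotProduct_mulVec]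
  ring

/-- reference embedding vectors -/
def refR1 : Matrix (Fin 23) (Fin 10) ℤ := Matrix.of fun r j =>
  if j = 0 then (if r = 1 then 2 else if r = 2 then 1 else 0)
  else if j = 1 then (if r = 0 then 1 else 0)
  else if r.val = j.val + 4 ∨ r.val = j.val + 12 then 1 else 0

def refX1 : Matrix (Fin 23) (Fin 10) ℤ := Matrix.of fun r j =>
  if j = 0 then (if r = 3 then 1 else 0)
  else if j = 1 then (if r = 1 then 1 else 0)
  else if 6 ≤ r.val ∧ r.val < 14 then -E8Inv (Fin.ofNat 8 (r.val - 6)) (Fin.ofNat 8 (j.val - 2))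
  else 0

def refR2 : Matrix (Fin 23) (Fin 10) ℤ := Matrix.of fun r j =>
  if j = 0 then (if r = 1 then 1 else 0)
  else if j = 1 then (if r = 0 then 1 else 0)
  else if r.val = j.val + 4 ∨ r.val = j.val + 12 then 1 else 0

def refX2 : Matrix (Fin 23) (Fin 10) ℤ := Matrix.of fun r j =>
  if j = 0 then (if r = 0 then 1 else 0)
  else if j = 1 then (if r = 1 then 1 else 0)
  else if 6 ≤ r.val ∧ r.val < 14 then -E8Inv (Fin.ofNat 8 (r.val - 6)) (Fin.ofNat 8 (j.val - 2))
  else 0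

/-- position of the `D₄` diagram inside the `E₈` diagram -/
def posD4 : Fin 6 → Fin 8 := ![0, 0, 1, 3, 2, 4]

def refR3 : Matrix (Fin 23) (Fin 6) ℤ := Matrix.of fun r j =>
  if j = 0 then (if r = 1 then 2 else if r = 2 then 1 else 0)
  else if j = 1 then (if r = 0 then 1 else 0)
  else if r.val = (posD4 j).val + 6 then 1 else 0

def refX3 : Matrix (Fin 23) (Fin 6) ℤ := Matrix.of fun r j =>
  if j = 0 then (if r = 3 then 1 else 0)
  else if j = 1 then (if r = 1 then 1 else 0)
  else if 6 ≤ r.val ∧ r.val < 14 then -E8Inv (Fin.ofNat 8 (r.val - 6)) (posD4 j)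
  else 0

theorem refR1_gram : refR1ᵀ * LMat * refR1 = T1Mat := by decide +kernel
theorem refX1_dual : refX1ᵀ * LMat * refR1 = 1 := by decide +kernel
theorem refR2_gram : refR2ᵀ * LMat * refR2 = T2Mat := by decide +kernel
theorem refX2_dual : refX2ᵀ * LMat * refR2 = 1 := by decide +kernel
theorem refR3_gram : refR3ᵀ * LMat * refR3 = T3Mat := by decide +kernel
theorem refX3_dual : refX3ᵀ * LMat * refR3 = 1 := by decide +kernel

theorem bform_mul {m n : ℕ} (G : Matrix (Fin n) (Fin n) ℤ) (M N : Matrix (Fin n) (Fin m) ℤ)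
    (v w : Fin m → ℤ) : bform G (M *ᵥ v) (N *ᵥ w) = bform (Mᵀ * G * N) v w := by
  unfold bform
  rw [← Matrix.mulVec_mulVec, ← Matrix.mulVec_mulVec, Matrix.dotProduct_mulVec v,
    Matrix.vecMul_transpose]

theorem bform_single {m : ℕ} (G : Matrix (Fin m) (Fin m) ℤ) (i j : Fin m) :
    bform G (Pi.single i 1) (Pi.single j 1) = G i j := by
  simp [bform]

theorem gram_eq {m n : ℕ} {G : Matrix (Fin n) (Fin n) ℤ} {GT : Matrix (Fin m) (Fin m) ℤ}
    {F : Matrix (Fin n) (Fin m) ℤ}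
    (h : ∀ v w : Fin m → ℤ, bform G (F *ᵥ v) (F *ᵥ w) = bform GT v w) : Fᵀ * G * F = GT := by
  ext i j
  rw [← bform_single (Fᵀ * G * F), ← bform_mul, h, bform_single]

/-- A primitive injective integral matrix has a left inverse. -/
theorem exists_left_inv {m n : ℕ} (F : Matrix (Fin n) (Fin m) ℤ)
    (hinj : Function.Injective F.mulVec)
    (hprim : ∀ (x : Fin n → ℤ) (c : ℤ), c ≠ 0 → (∃ v, c • x = F *ᵥ v) → ∃ v, x = F *ᵥ v) :
    ∃ R : Matrix (Fin m) (Fin n) ℤ, R * F = 1 := by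
  let N := LinearMap.range F.mulVecLin
  have htf : Module.IsTorsionFree ℤ ((Fin n → ℤ) ⧸ N) := by
    rw [Module.isTorsionFree_iff_smul_eq_zero]
    intro c y hy
    obtain ⟨x, rfl⟩ := N.mkQ_surjective y
    by_cases hc : c = 0
    · exact Or.inl hc
    · right
      rw [← map_smul, Submodule.mkQ_apply, Submodule.Quotient.mk_eq_zero] at hy
      obtain ⟨v, hv⟩ := hy
      obtain ⟨u, hu⟩ := hprim x c hc ⟨v, hv.symm⟩
      rw [Submodule.mkQ_apply, Submodule.Quotient.mk_eq_zero]
      exact ⟨u, hu.symm⟩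
  have : Module.Free ℤ ((Fin n → ℤ) ⧸ N) := Module.free_of_finite_type_torsion_free'
  obtain ⟨s, hsec⟩ := Module.projective_lifting_property N.mkQ LinearMap.id N.mkQ_surjective
  have hmem : ∀ x, (LinearMap.id - s ∘ₗ N.mkQ : (Fin n → ℤ) →ₗ[ℤ] (Fin n → ℤ)) x ∈ N := by
    intro x
    rw [← Submodule.Quotient.mk_eq_zero, ← Submodule.mkQ_apply]
    have := LinearMap.congr_fun hsec (N.mkQ x)
    simp only [LinearMap.comp_apply, LinearMap.id_apply] at this
    simp only [LinearMap.sub_apply, LinearMap.id_apply, LinearMap.comp_apply, map_sub, this,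
      sub_self]
  have hinj' : Function.Injective F.mulVecLin := hinj
  let r : (Fin n → ℤ) →ₗ[ℤ] (Fin m → ℤ) :=
    (LinearEquiv.ofInjective F.mulVecLin hinj').symm.toLinearMap ∘ₗ
      LinearMap.codRestrict N (LinearMap.id - s ∘ₗ N.mkQ) hmem
  have hr : ∀ v, r (F *ᵥ v) = v := by
    intro v
    simp only [r, LinearMap.comp_apply, LinearEquiv.coe_coe]
    rw [LinearEquiv.symm_apply_eq]
    ext1
    have : N.mkQ (F *ᵥ v) = 0 := by
      rw [Submodule.mkQ_apply, Submodule.Quotient.mk_eq_zero]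
      exact ⟨v, rfl⟩
    simp [this]
  refine ⟨LinearMap.toMatrix' r, ?_⟩
  apply Matrix.toLin'.injective
  rw [Matrix.toLin'_mul, Matrix.toLin'_toMatrix', Matrix.toLin'_one]
  refine LinearMap.ext fun v => ?_
  simpa using hr v

theorem exists_dual {m : ℕ} (GT : Matrix (Fin m) (Fin m) ℤ) (F : Matrix (Fin 23) (Fin m) ℤ)
    (hF : IsPrimitiveIsometricEmb GT LMat F)
    (hT : ∀ c, (∀ v, 2 ∣ bform GT v c) → 4 ∣ bform GT c c) :
    ∃ X : Matrix (Fin 23) (Fin m) ℤ, Xᵀ * LMat * F = 1 := by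
  obtain ⟨hinj, hiso, hprim⟩ := hF
  obtain ⟨R, hR⟩ := exists_left_inv F hinj hprim
  -- the mod 2 statement
  have key : ∀ c : Fin m → ℤ, (∀ i, 2 ∣ (LMat *ᵥ (F *ᵥ c)) i) → ∀ i, 2 ∣ c i := by
    intro c hc
    choose y hy using hc
    have hy' : LMat *ᵥ (F *ᵥ c) = (2 : ℤ) • y := by ext i; simp [hy]
    have h4 := hT c (fun v => ⟨(F *ᵥ v) ⬝ᵥ y, by
      rw [← hiso, bform, hy', dotProduct_smul, smul_eq_mul]⟩)
    rw [← hiso] at h4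
    have hz : ∀ i, (if i = (22 : Fin 23) then 2 else 1) * (F *ᵥ c) i = 2 * (LInv *ᵥ y) i := by
      intro i
      have := congrFun (congrArg (LInv *ᵥ ·) hy') i
      simp only [Matrix.mulVec_smul] at this
      rw [Matrix.mulVec_mulVec, LInv_mul, Matrix.mulVec_diagonal] at this
      simpa using this
    have hdiv : ∀ i, 2 ∣ (F *ᵥ c) i := by
      generalize F *ᵥ c = z at *
      have hne : ∀ i, i ≠ 22 → z i = 2 * (LInv *ᵥ y) i := by
        intro i hi
        simpa [hi] using hz i
      have hzz : z = (2 : ℤ) • (fun i => if i = 22 then 0 else (LInv *ᵥ y) i)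
          + z 22 • (Pi.single 22 1 : Fin 23 → ℤ) := by
        ext i
        by_cases hi : i = 22
        · subst hi; simp
        · simp [hi, hne i hi]
      have h22 : 2 ∣ z 22 := by
        generalize (fun i => if i = 22 then 0 else (LInv *ᵥ y) i) = u at hzz
        generalize z 22 = k at hzz
        have hK : halfMat LMat 22 22 = -1 := by decide +kernel
        rw [← LMat_half, bform_half, hzz] at h4
        generalize halfMat LMat = K at *
        have hd : (Pi.single 22 1 : Fin 23 → ℤ) ⬝ᵥ K *ᵥ (Pi.single 22 1) = -1 := by
          simpa using hK
        simp only [Matrix.mulVec_add, Matrix.mulVec_smul, dotProduct_add, add_dotProduct,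
          dotProduct_smul, smul_dotProduct, smul_eq_mul, hd] at h4
        generalize u ⬝ᵥ K *ᵥ u = A1 at h4
        generalize (Pi.single 22 1 : Fin 23 → ℤ) ⬝ᵥ K *ᵥ u = A2 at h4
        generalize u ⬝ᵥ K *ᵥ (Pi.single 22 1 : Fin 23 → ℤ) = A3 at h4
        obtain ⟨t, ht⟩ := h4
        have : 2 ∣ k * k := ⟨2 * A1 + k * A2 + k * A3 - t, by linarith⟩
        exact (Int.prime_two.dvd_or_dvd this).elim id id
      intro i
      by_cases hi : i = 22
      · rw [hi]; exact h22
      · exact ⟨_, hne i hi⟩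
    choose x hx using hdiv
    have hx' : F *ᵥ c = (2 : ℤ) • x := by ext i; simp [hx]
    obtain ⟨v, hv⟩ := hprim x 2 two_ne_zero ⟨c, hx'.symm⟩
    have hcv : c = (2 : ℤ) • v := hinj (by rw [hx', hv, Matrix.mulVec_smul])
    intro i
    exact ⟨v i, by rw [hcv]; simp⟩
  -- mod 2 left inverse
  let cast2 : ℤ →+* ZMod 2 := Int.castRingHom (ZMod 2)
  let A := LMat * F
  let Ab : Matrix (Fin 23) (Fin m) (ZMod 2) := A.map cast2
  have hker : LinearMap.ker Ab.mulVecLin = ⊥ := by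
    rw [LinearMap.ker_eq_bot']
    intro cb hcb
    have hlift : cb = cast2 ∘ (fun i => ((cb i).val : ℤ)) := by
      ext i; simp [cast2]
    rw [Matrix.mulVecLin_apply] at hcb
    rw [hlift] at hcb
    have h2 := key (fun i => ((cb i).val : ℤ)) (fun i => by
      have h := congrFun hcb i
      have h3 := RingHom.map_mulVec cast2 A (fun i => ((cb i).val : ℤ)) i
      rw [h, Pi.zero_apply] at h3
      rw [Matrix.mulVec_mulVec]
      exact (ZMod.intCast_zmod_eq_zero_iff_dvd _ 2).1 h3)
    ext i
    rw [hlift]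
    exact (ZMod.intCast_zmod_eq_zero_iff_dvd _ 2).2 (h2 i)
  obtain ⟨g, hg⟩ := Ab.mulVecLin.exists_leftInverse_of_injective hker
  let Y : Matrix (Fin m) (Fin 23) ℤ := Matrix.of fun i j => ((LinearMap.toMatrix' g i j).val : ℤ)
  have hY : Y.map cast2 = LinearMap.toMatrix' g := by ext i j; simp [Y, cast2]
  have hYA : (Y * A).map cast2 = 1 := by
    rw [Matrix.map_mul, hY]
    apply Matrix.toLin'.injective
    rw [Matrix.toLin'_mul, Matrix.toLin'_toMatrix', Matrix.toLin'_one]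
    exact hg
  have hW : ∀ i j, ∃ w, (Y * A) i j = (1 : Matrix (Fin m) (Fin m) ℤ) i j + 2 * w := by
    intro i j
    have h := congrFun (congrFun hYA i) j
    have : ((( Y * A) i j - (1 : Matrix (Fin m) (Fin m) ℤ) i j : ℤ) : ZMod 2) = 0 := by
      rw [Int.cast_sub]
      have h' : (((Y * A) i j : ℤ) : ZMod 2) = (1 : Matrix (Fin m) (Fin m) (ZMod 2)) i j := h
      rw [h', Matrix.one_apply, Matrix.one_apply]
      split <;> simp
    obtain ⟨w, hw⟩ := (ZMod.intCast_zmod_eq_zero_iff_dvd _ 2).1 this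
    exact ⟨w, by push_cast at hw; linarith⟩
  choose W hW using hW
  have hYW : Y * A = 1 + (2 : ℤ) • Matrix.of W := by
    ext i j; rw [hW]; simp
  have hH : (Matrix.diagonal (fun i : Fin 23 => if i = 22 then 1 else 2) * LInv) * LMat
      = (2 : ℤ) • (1 : Matrix (Fin 23) (Fin 23) ℤ) := by
    rw [Matrix.mul_assoc, LInv_mul, Matrix.diagonal_mul_diagonal, Matrix.smul_one_eq_diagonal]
    congr 1
    ext i
    split <;> simp
  generalize Matrix.diagonal (fun i : Fin 23 => if i = 22 then (1 : ℤ) else 2) * LInv = H at hH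
  refine ⟨(Y - Matrix.of W * R * H)ᵀ, ?_⟩
  rw [Matrix.transpose_transpose, Matrix.mul_assoc, Matrix.sub_mul, hYW,
    Matrix.mul_assoc (Matrix.of W * R), ← Matrix.mul_assoc H, hH, Matrix.smul_mul, Matrix.one_mul,
    Matrix.mul_smul, Matrix.mul_assoc, hR, Matrix.mul_one]
  simp

theorem T1_cond (c : Fin 10 → ℤ) : 4 ∣ bform T1Mat c c := by
  have h : ∃ K : Matrix (Fin 10) (Fin 10) ℤ, (2 : ℤ) • K + ((2 : ℤ) • K)ᵀ = T1Mat :=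
    ⟨dsum (halfMat UMat) (-halfMat E8Mat), by decide +kernel⟩
  obtain ⟨K, hK⟩ := h
  rw [← hK, bform_half, Matrix.smul_mulVec, dotProduct_smul, smul_eq_mul]
  exact ⟨_, by ring⟩

theorem T2_cond (c : Fin 10 → ℤ) (hc : ∀ v, 2 ∣ bform T2Mat v c) : 4 ∣ bform T2Mat c c := by
  have h : ∃ K : Matrix (Fin 10) (Fin 10) ℤ,
      (Matrix.single 0 1 1 + (2 : ℤ) • K) + (Matrix.single 0 1 1 + (2 : ℤ) • K)ᵀ = T2Mat :=
    ⟨dsum 0 (-halfMat E8Mat), by decide +kernel⟩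
  have h0 : T2Mat.row 0 = Pi.single 1 1 := by decide +kernel
  have h1 := hc (Pi.single 0 1)
  rw [bform, single_one_dotProduct, Matrix.mulVec, show T2Mat 0 = _ from h0,
    single_one_dotProduct] at h1
  obtain ⟨K, hK⟩ := h
  rw [← hK, bform_half, Matrix.add_mulVec, dotProduct_add, Matrix.smul_mulVec, dotProduct_smul,
    smul_eq_mul]
  have : c ⬝ᵥ Matrix.single 0 1 (1 : ℤ) *ᵥ c = c 0 * c 1 := by
    rw [Matrix.single_mulVec, one_mul]
    exact dotProduct_single c (c 1) 0
  rw [this]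
  obtain ⟨t, ht⟩ := h1
  rw [ht]
  exact ⟨c 0 * t + c ⬝ᵥ K *ᵥ c, by ring⟩

theorem T3_cond (c : Fin 6 → ℤ) (hc : ∀ v, 2 ∣ bform T3Mat v c) : 4 ∣ bform T3Mat c c := by
  have h : T3Mat = !![0, 2, 0, 0, 0, 0; 2, 0, 0, 0, 0, 0; 0, 0, -2, 1, 0, 0; 0, 0, 1, -2, 1, 1;
     0, 0, 0, 1, -2, 0; 0, 0, 0, 1, 0, -2] := by decide +kernel
  have h1 := hc (Pi.single 2 1)
  have h2 := hc (Pi.single 3 1)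
  rw [h] at h1 h2 ⊢
  have e1 : ((2 : ℤ) ∣ -2 * c 2 + c 3) := by
    convert h1 using 1
    simp [bform, Matrix.mulVec, dotProduct, Fin.sum_univ_six]
  have e2 : ((2 : ℤ) ∣ c 2 + -2 * c 3 + c 4 + c 5) := by
    convert h2 using 1
    simp [bform, Matrix.mulVec, dotProduct, Fin.sum_univ_six]
  obtain ⟨b, hb⟩ : (2 : ℤ) ∣ c 3 := by omega
  obtain ⟨t, ht⟩ : (2 : ℤ) ∣ c 2 + c 4 + c 5 := by omega
  have h5 : c 5 = 2 * t - c 2 - c 4 := by linarith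
  simp only [bform, Matrix.mulVec, dotProduct, Fin.sum_univ_six]
  simp only [Matrix.of_apply, Matrix.cons_val]
  rw [hb, h5]
  refine ⟨2 * t * (b - t) + 2 * t * (c 2 + c 4) - c 2 * c 2 - c 4 * c 4 - c 2 * c 4
    + c 0 * c 1 - 2 * b * b, ?_⟩
  ring

theorem toBilin_col {m : ℕ} (G : Matrix (Fin 23) (Fin 23) ℤ) (M N : Matrix (Fin 23) (Fin m) ℤ)
    (i j : Fin m) : Matrix.toBilin' G (M.col i) (N.col j) = (Mᵀ * G * N) i j := by
  rw [← bform_single (Mᵀ * G * N), ← bform_mul, Matrix.toBilin'_apply', bform]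
  simp

theorem conj_of_ref {m : ℕ} (GT : Matrix (Fin m) (Fin m) ℤ) (R0 X0 : Matrix (Fin 23) (Fin m) ℤ)
    (hR : R0ᵀ * LMat * R0 = GT) (hX : X0ᵀ * LMat * R0 = 1)
    (hz : ∀ i : Fin m, 0 < i.val → ∀ r : Fin 23, 2 ≤ r.val → r.val < 6 → (LMat * R0) r i = 0)
    (hT : ∀ c, (∀ v, 2 ∣ bform GT v c) → 4 ∣ bform GT c c) : EmbeddingsConjugate GT := by
  have hBb : ∀ v w, Matrix.toBilin' LMat v w = bform LMat v w := fun v w => by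
    rw [Matrix.toBilin'_apply', bform]
  have hs : ∀ x y, Matrix.toBilin' LMat x y = Matrix.toBilin' LMat y x := by
    intro x y
    rw [hBb, hBb]
    unfold bform
    conv_lhs => rw [← LMat_symm, Matrix.mulVec_transpose, dotProduct_comm,
      ← Matrix.dotProduct_mulVec]
  have hev : ∀ x, ∃ q, Matrix.toBilin' LMat x x = 2 * q := fun x => by
    rw [hBb, ← LMat_half, bform_half]
    exact ⟨_, rfl⟩
  have hsing : ∀ i j : Fin 23, Matrix.toBilin' LMat (Pi.single i 1) (Pi.single j 1) = LMat i j :=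
    fun i j => by rw [hBb, bform_single]
  have hcol : ∀ (r : Fin 23), 2 ≤ r.val → r.val < 6 →
      ∀ s ∈ {s | ∃ i : Fin m, 0 < (i : ℕ) ∧ s = R0.col i},
      Matrix.toBilin' LMat (Pi.single r 1) s = 0 := by
    rintro r h2 h6 s ⟨i, hi, rfl⟩
    rw [hBb, bform, single_one_dotProduct]
    exact hz i hi r h2 h6
  have hyp : Hyp (Matrix.toBilin' LMat) {s | ∃ i : Fin m, 0 < (i : ℕ) ∧ s = R0.col i}
      (Pi.single 2 1) (Pi.single 3 1) (Pi.single 4 1) (Pi.single 5 1) := by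
    constructor
    iterate 10 (rw [hsing]; decide +kernel)
    · exact hcol 2 (by decide) (by decide)
    · exact hcol 3 (by decide) (by decide)
    · exact hcol 4 (by decide) (by decide)
    · exact hcol 5 (by decide) (by decide)
  have main : ∀ F : Matrix (Fin 23) (Fin m) ℤ, IsPrimitiveIsometricEmb GT LMat F →
      ∃ g : (Fin 23 → ℤ) ≃ₗ[ℤ] (Fin 23 → ℤ),
        (∀ x y, bform LMat (g x) (g y) = bform LMat x y) ∧ ∀ i, g (F.col i) = R0.col i := by
    intro F hF
    obtain ⟨X, hXF⟩ := exists_dual GT F hF hT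
    simp only [← hBb]
    refine chain hs hev R0.col F.col X0.col X.col hyp ?_ ?_ ?_
    · intro i j
      rw [toBilin_col, toBilin_col, hR, gram_eq hF.2.1]
    · intro i j
      rw [toBilin_col, hX, Matrix.one_apply]
    · intro i j
      rw [toBilin_col, hXF, Matrix.one_apply]
  intro F₁ F₂ h₁ h₂
  obtain ⟨g, g1, g2⟩ := main F₁ h₁
  obtain ⟨l, l1, l2⟩ := main F₂ h₂
  let p := g.trans l.symm
  have hP : ∀ v, LinearMap.toMatrix' p.toLinearMap *ᵥ v = p v := fun v => by
    rw [LinearMap.toMatrix'_mulVec]; rfl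
  refine ⟨LinearMap.toMatrix' p.toLinearMap,
    ⟨LinearMap.toMatrix' p.symm.toLinearMap, ?_, ?_⟩, ?_, ?_⟩
  · rw [← LinearMap.toMatrix'_comp]; simp
  · rw [← LinearMap.toMatrix'_comp]; simp
  · intro v w
    rw [hP, hP, ← l1]
    simp [p, g1]
  · ext r i
    have h := congrFun (hP (F₁.col i)) r
    have h' : p (F₁.col i) = F₂.col i := by
      simp only [p, LinearEquiv.trans_apply]
      rw [LinearEquiv.symm_apply_eq, g2, l2]
    rw [h'] at h
    exact h

/-- For `T` any of the three lattices `U(2) ⊕ E₈(-2)`, `U ⊕ E₈(-2)`,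
`U(2) ⊕ D₄(-1)`, any two primitive isometric embeddings of `T` into
`L = U³ ⊕ E₈(-1)² ⊕ ⟨-2⟩` are conjugate under an isometry `g` of `L`
(with `g ∘ f₁ = f₂`). -/
theorem embeddings_in_L_conjugate :
    EmbeddingsConjugate T1Mat ∧ EmbeddingsConjugate T2Mat ∧ EmbeddingsConjugate T3Mat := by
  refine ⟨conj_of_ref T1Mat refR1 refX1 refR1_gram refX1_dual (by decide +kernel)
      (fun c _ => T1_cond c),
    conj_of_ref T2Mat refR2 refX2 refR2_gram refX2_dual (by decide +kernel) T2_cond,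
    conj_of_ref T3Mat refR3 refX3 refR3_gram refX3_dual (by decide +kernel) T3_cond⟩
end

section
/- Let M be an even lattice of rank 10 admitting an isometric embedding ι : U(2) ⊕ E₈(−2) → M whose image has finite index in M (i.e. M/ι(U(2) ⊕ E₈(−2)) is finite), and such that ι(U(2)) and ι(E₈(−2)) are primitive sublattices of M. Then M is isometric to one of the following three lattices: U(2) ⊕ E₈(−2), U ⊕ E₈(−2), or U(2) ⊕ D₄(−1) ⊕ D₄(−1). -/
open Matrix

namespace OL

abbrev V := Fin 10 → ℤ

def LM : Matrix (Fin 10) (Fin 10) ℤ := dsum UMat (-E8Mat)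

def LMi : Matrix (Fin 10) (Fin 10) ℤ :=
  !![0, 1, 0, 0, 0, 0, 0, 0, 0, 0;
    1, 0, 0, 0, 0, 0, 0, 0, 0, 0;
    0, 0, -4, -5, -7, -10, -8, -6, -4, -2;
    0, 0, -5, -8, -10, -15, -12, -9, -6, -3;
    0, 0, -7, -10, -14, -20, -16, -12, -8, -4;
    0, 0, -10, -15, -20, -30, -24, -18, -12, -6;
    0, 0, -8, -12, -16, -24, -20, -15, -10, -5;
    0, 0, -6, -9, -12, -18, -15, -12, -8, -4;
    0, 0, -4, -6, -8, -12, -10, -8, -6, -3;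
    0, 0, -2, -3, -4, -6, -5, -4, -3, -2]

lemma LM_eq : LM = !![0, 1, 0, 0, 0, 0, 0, 0, 0, 0;
    1, 0, 0, 0, 0, 0, 0, 0, 0, 0;
    0, 0, -2, 0, 1, 0, 0, 0, 0, 0;
    0, 0, 0, -2, 0, 1, 0, 0, 0, 0;
    0, 0, 1, 0, -2, 1, 0, 0, 0, 0;
    0, 0, 0, 1, 1, -2, 1, 0, 0, 0;
    0, 0, 0, 0, 0, 1, -2, 1, 0, 0;
    0, 0, 0, 0, 0, 0, 1, -2, 1, 0;
    0, 0, 0, 0, 0, 0, 0, 1, -2, 1;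
    0, 0, 0, 0, 0, 0, 0, 0, 1, -2] := by decide +kernel

lemma T1_eq : T1Mat = (2:ℤ) • LM := by decide +kernel

lemma LM_LMi : LM * LMi = 1 := by decide +kernel

/-- The unimodular form, as a bilinear form. -/
noncomputable def h : LinearMap.BilinForm ℤ V := Matrix.toBilin' LM

lemma h_eq (x y : V) : h x y = bform LM x y := by
  rw [h, Matrix.toBilin'_apply', bform]

lemma bform_T1 (x y : V) : bform T1Mat x y = 2 * h x y := by
  rw [h_eq, T1_eq, bform, bform, Matrix.smul_mulVec, dotProduct_smul, smul_eq_mul]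

/-- The E8 form as an explicit polynomial. -/
def B {R : Type*} [CommRing R] (x y : Fin 8 → R) : R :=
  2 * (x 0 * y 0 + x 1 * y 1 + x 2 * y 2 + x 3 * y 3 + x 4 * y 4 + x 5 * y 5 + x 6 * y 6
    + x 7 * y 7)
  - (x 0 * y 2 + x 2 * y 0) - (x 2 * y 3 + x 3 * y 2) - (x 1 * y 3 + x 3 * y 1)
  - (x 3 * y 4 + x 4 * y 3) - (x 4 * y 5 + x 5 * y 4) - (x 5 * y 6 + x 6 * y 5)
  - (x 6 * y 7 + x 7 * y 6)

def q {R : Type*} [CommRing R] (x : Fin 8 → R) : R :=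
  (x 0 * x 0 + x 1 * x 1 + x 2 * x 2 + x 3 * x 3 + x 4 * x 4 + x 5 * x 5 + x 6 * x 6
    + x 7 * x 7)
  - x 0 * x 2 - x 2 * x 3 - x 1 * x 3 - x 3 * x 4 - x 4 * x 5 - x 5 * x 6 - x 6 * x 7

lemma B_self {R : Type*} [CommRing R] (x : Fin 8 → R) : B x x = 2 * q x := by
  unfold B q; ring

def ep (v : V) : Fin 8 → ℤ := fun i => v (Fin.natAdd 2 i)

lemma h_apply (x y : V) : h x y = x 0 * y 1 + x 1 * y 0 - B (ep x) (ep y) := by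
  rw [h_eq, LM_eq]
  simp only [bform, dotProduct, Matrix.mulVec, Fin.sum_univ_succ, Fin.sum_univ_zero]
  simp [B, ep]
  ring

lemma h_symm (x y : V) : h x y = h y x := by
  rw [h_apply, h_apply]; unfold B; ring

def f1 : V := Pi.single 0 1
def f2 : V := Pi.single 1 1
def j (e : Fin 8 → ℤ) : V := Fin.append (0 : Fin 2 → ℤ) e

lemma ep_j (e) : ep (j e) = e := by
  ext i; simp [ep, j]
lemma j_zero' (e) : j e 0 = 0 := rfl
lemma j_one' (e) : j e 1 = 0 := rfl
lemma ep_f1 : ep f1 = 0 := by decide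
lemma ep_f2 : ep f2 = 0 := by decide
lemma B_zero (x : Fin 8 → ℤ) : B x 0 = 0 := by simp [B]
lemma B_zero' (x : Fin 8 → ℤ) : B 0 x = 0 := by simp [B]

lemma h_f1 (x : V) : h x f1 = x 1 := by
  rw [h_apply, ep_f1, B_zero]; simp [f1]
lemma h_f2 (x : V) : h x f2 = x 0 := by
  rw [h_apply, ep_f2, B_zero]; simp [f2]
lemma h_f1' (x : V) : h f1 x = x 1 := by rw [h_symm, h_f1]
lemma h_f2' (x : V) : h f2 x = x 0 := by rw [h_symm, h_f2]
lemma h_j (e e') : h (j e) (j e') = - B e e' := by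
  rw [h_apply, ep_j, ep_j]; simp [j_zero', j_one']

lemma j_add (e e') : j (e + e') = j e + j e' := by
  ext i; refine Fin.addCases (m := 2) (n := 8) (fun i => ?_) (fun i => ?_) i <;> simp [j]
lemma j_smul (c : ℤ) (e) : j (c • e) = c • j e := by
  ext i; refine Fin.addCases (m := 2) (n := 8) (fun i => ?_) (fun i => ?_) i <;> simp [j]
lemma j_sub (e e') : j (e - e') = j e - j e' := by
  ext i; refine Fin.addCases (m := 2) (n := 8) (fun i => ?_) (fun i => ?_) i <;> simp [j]

lemma decomp (v : V) : v = v 0 • f1 + v 1 • f2 + j (ep v) := by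
  ext i; refine Fin.addCases (m := 2) (n := 8) (fun i => ?_) (fun i => ?_) i
  · fin_cases i <;> simp [f1, f2, j]
    · exact (j_zero' (ep v)).symm
    · exact (j_one' (ep v)).symm
  · have h0 : (Fin.natAdd 2 i : Fin 10) ≠ 0 := by intro hh; have := congrArg Fin.val hh; simp at this
    have h1 : (Fin.natAdd 2 i : Fin 10) ≠ 1 := by
      intro hh; have := congrArg Fin.val hh; simp at this; omega
    simp [f1, f2, j, ep, h0, h1]

def IsT (T : Matrix (Fin 10) (Fin 10) ℤ) : Prop :=
  T = T1Mat ∨ T = T2Mat ∨ T = dsum ((2 : ℤ) • UMat) (dsum (-D4Mat) (-D4Mat))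

def Good (N : Set V) : Prop :=
  ∃ T, IsT T ∧ ∃ φ : V →ₗ[ℤ] V, (∀ k l, h (φ k) (φ l) = 2 * bform T k l) ∧
    ∀ v, v ∈ N ↔ ∃ k, v = φ k

lemma Good.map {N N' : Set V} (g g' : V →ₗ[ℤ] V) (hg : ∀ x y, h (g x) (g y) = h x y)
    (hgg : ∀ v, g (g' v) = v) (h1 : ∀ v ∈ N', g v ∈ N) (h2 : ∀ v ∈ N, g' v ∈ N')
    (H : Good N') : Good N := by
  obtain ⟨T, hT, φ, hφ, hN⟩ := H
  refine ⟨T, hT, g.comp φ, fun k l => by simp [hg, hφ], fun v => ⟨fun hv => ?_, ?_⟩⟩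
  · obtain ⟨k, hk⟩ := (hN _).1 (h2 v hv)
    exact ⟨k, by simp [← hk, hgg]⟩
  · rintro ⟨k, rfl⟩
    exact h1 _ ((hN _).2 ⟨k, rfl⟩)

lemma bform_mul (G A : Matrix (Fin 10) (Fin 10) ℤ) (k l : V) :
    bform G (A *ᵥ k) (A *ᵥ l) = bform (Aᵀ * G * A) k l := by
  simp only [bform, Matrix.mul_assoc]
  rw [← Matrix.mulVec_mulVec, ← Matrix.mulVec_mulVec, Matrix.dotProduct_mulVec k,
    Matrix.vecMul_transpose]

lemma Good.of_matrix {N : Set V} (T A : Matrix (Fin 10) (Fin 10) ℤ) (hT : IsT T)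
    (hA : Aᵀ * LM * A = (2:ℤ) • T) (hN : ∀ v, v ∈ N ↔ ∃ k, v = A *ᵥ k) : Good N := by
  refine ⟨T, hT, A.mulVecLin, fun k l => ?_, by simpa using hN⟩
  rw [h_eq, Matrix.mulVecLin_apply, Matrix.mulVecLin_apply, bform_mul, hA, bform, bform,
    Matrix.smul_mulVec, dotProduct_smul, smul_eq_mul]

/-- The span of `f1`, `j e` and `2V`. -/
def Nc (e : Fin 8 → ℤ) : Set V := {v | ∃ (a b : ℤ) (w : V), v = a • f1 + b • j e + (2:ℤ) • w}

lemma good_two : Good {v | ∃ w : V, v = (2:ℤ) • w} := by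
  refine Good.of_matrix T1Mat ((2:ℤ) • 1) (Or.inl rfl) ?_ ?_
  · decide +kernel
  · intro v; simp [Matrix.smul_mulVec]

def A2 : Matrix (Fin 10) (Fin 10) ℤ := Matrix.diagonal ![1,2,2,2,2,2,2,2,2,2]

lemma good_zero : Good (Nc 0) := by
  refine Good.of_matrix T2Mat A2 (Or.inr (Or.inl rfl)) ?_ ?_
  · decide +kernel
  · intro v
    have j0 : j 0 = 0 := by decide
    constructor
    · rintro ⟨a, b, w, rfl⟩
      refine ⟨a • f1 + w + w 0 • f1, ?_⟩
      ext i
      rw [A2, Matrix.mulVec_diagonal, j0]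
      fin_cases i <;> simp [f1] <;> ring
    · rintro ⟨k, rfl⟩
      refine ⟨k 0, 0, k - k 0 • f1, ?_⟩
      ext i
      rw [A2, Matrix.mulVec_diagonal, j0]
      fin_cases i <;> simp [f1]

def e0 : Fin 8 → ℤ := ![-1, 0, 0, 0, -1, 0, 0, 0]

def A3 : Matrix (Fin 10) (Fin 10) ℤ :=
  !![8, 10, 7, -5, 1, 1, -9, 9, -3, -3;
    4, 8, 4, -2, 0, 0, -6, 6, -2, -2;
    -2, -4, -3, 2, -1, -1, 2, -3, 0, 0;
    -2, -4, -2, 2, 0, -2, 2, -4, 0, 0;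
    -4, -6, -4, 2, 0, -2, 4, -6, 0, 0;
    0, 0, 0, 0, 0, -2, -2, -2, -2, -2;
    0, 0, -1, 0, 1, -1, -2, -1, -2, -2;
    -4, -6, -4, 2, 0, 0, 4, -6, 0, 0;
    0, 0, 0, 0, 0, 0, 0, 0, -2, -2;
    0, 0, 0, 0, 0, 0, 0, 0, 0, -2]
def A3i : Matrix (Fin 10) (Fin 10) ℤ :=
  !![4, 5, 1, 4, 4, -5, -3, 6, -3, 0;
    2, 4, 0, 2, 3, -3, -2, 4, -2, 0;
    -2, -3, -1, -1, -3, 3, 1, -3, 2, 0;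
    0, 1, 0, 2, -1, -1, 0, 1, 0, 0;
    0, 0, -1, 1, 0, -1, 1, 0, 0, 0;
    0, 0, 0, 0, -1, 0, 0, 1, 0, 0;
    2, 3, 0, 2, 3, -3, -2, 3, -1, 0;
    -2, -3, 0, -2, -2, 2, 2, -4, 2, 0;
    0, 0, 0, 0, 0, 0, 0, 0, -1, 1;
    0, 0, 0, 0, 0, 0, 0, 0, 0, -1]
def A3w : Matrix (Fin 10) (Fin 10) ℤ :=
  !![4, 5, 3, -3, 0, 0, -5, 4, -2, -2;
    2, 4, 2, -1, 0, 0, -3, 3, -1, -1;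
    -1, -2, -1, 1, 0, 0, 1, -1, 0, 0;
    -1, -2, -1, 1, 0, -1, 1, -2, 0, 0;
    -2, -3, -2, 1, 0, -1, 2, -3, 0, 0;
    0, 0, 0, 0, 0, -1, -1, -1, -1, -1;
    0, 0, 0, 0, 1, 0, -1, 0, -1, -1;
    -2, -3, -2, 1, 0, 0, 2, -3, 0, 0;
    0, 0, 0, 0, 0, 0, 0, 0, -1, -1;
    0, 0, 0, 0, 0, 0, 0, 0, 0, -1]
def xs : V := ![0, 0, 1, 1, 1, 1, 1, 1, 1, 1]
def ys : V := ![0, 0, 1, 0, 1, 1, 0, 1, 0, 0]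
def k1 : V := ![2, 1, -1, 0, 0, 0, 1, -1, 0, 0]
def k2 : V := ![1, 1, 0, 0, 0, 0, 1, -1, 0, 0]

lemma good_e0 : Good (Nc e0) := by
  refine Good.of_matrix _ A3 (Or.inr (Or.inr rfl)) ?_ ?_
  · decide +kernel
  · intro v
    constructor
    · rintro ⟨a, b, w, rfl⟩
      refine ⟨a • k1 + b • k2 + A3i *ᵥ w, ?_⟩
      have e1 : A3 *ᵥ k1 = f1 := by decide +kernel
      have e2 : A3 *ᵥ k2 = j e0 := by decide +kernel
      have e3 : A3 * A3i = (2:ℤ) • 1 := by decide +kernel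
      rw [Matrix.mulVec_add, Matrix.mulVec_add, Matrix.mulVec_smul, Matrix.mulVec_smul, e1, e2,
        Matrix.mulVec_mulVec, e3, Matrix.smul_mulVec, Matrix.one_mulVec]
    · rintro ⟨k, rfl⟩
      refine ⟨xs ⬝ᵥ k, ys ⬝ᵥ k, A3w *ᵥ k, ?_⟩
      have : A3 = Matrix.vecMulVec f1 xs + Matrix.vecMulVec (j e0) ys + (2:ℤ) • A3w := by
        decide +kernel
      rw [this, Matrix.add_mulVec, Matrix.add_mulVec, Matrix.smul_mulVec,
        Matrix.vecMulVec_mulVec, Matrix.vecMulVec_mulVec]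
      simp

def Ev (e : Fin 8 → ℤ) : Prop := ∃ w : Fin 8 → ℤ, e = (2:ℤ) • w

lemma B_sub_right (e a b : Fin 8 → ℤ) : B e (a - b) = B e a - B e b := by
  simp only [B, Pi.sub_apply]; ring
lemma B_comm (a b : Fin 8 → ℤ) : B a b = B b a := by
  unfold B; ring
lemma q_sub (a b : Fin 8 → ℤ) : q (a - b) = q a + q b - B a b := by
  simp only [B, q, Pi.sub_apply]; ring

lemma refl_iso (D : V) (hD : h D D = -2) (x y : V) :
    h (x + h x D • D) (y + h y D • D) = h x y := by
  simp only [map_add, LinearMap.add_apply, map_smul, LinearMap.smul_apply, smul_eq_mul, hD,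
    h_symm D y]
  ring

lemma refl_refl (D : V) (hD : h D D = -2) (x : V) :
    (x + h x D • D) + h (x + h x D • D) D • D = x := by
  simp only [map_add, LinearMap.add_apply, map_smul, LinearMap.smul_apply, smul_eq_mul, hD]
  module

lemma step (e e' : Fin 8 → ℤ) (he : 2 ∣ q e) (he' : 2 ∣ q e') (hB : B e e' % 2 = 1)
    (H : Good (Nc e)) : Good (Nc e') := by
  obtain ⟨t, ht⟩ : ∃ t, q (e - e') - 1 = 2 * t := by
    rw [q_sub]
    exact ⟨(q e + q e' - B e e' - 1) / 2, by omega⟩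
  obtain ⟨s, hs⟩ : ∃ s, B e e' = 2 * s + 1 := ⟨B e e' / 2, by omega⟩
  set D : V := f1 + (2 * t) • f2 + (j e - j e') with hDdef
  have hxD : ∀ x, h x D = x 1 + 2 * t * x 0 + h x (j e) - h x (j e') := by
    intro x
    simp only [hDdef, map_add, map_sub, map_smul, h_f1, h_f2, smul_eq_mul]; ring
  have hfe : ∀ e : Fin 8 → ℤ, h f1 (j e) = 0 := fun e => by rw [h_f1', j_one']
  have hfe2 : ∀ e : Fin 8 → ℤ, h f2 (j e) = 0 := fun e => by rw [h_f2', j_zero']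
  have f10 : f1 0 = 1 := rfl
  have f11 : f1 1 = 0 := rfl
  have f20 : f2 0 = 0 := rfl
  have f21 : f2 1 = 1 := rfl
  have hf1D : h f1 D = 2 * t := by rw [hxD, hfe, hfe, f10, f11]; ring
  have hf2D : h f2 D = 1 := by rw [hxD, hfe2, hfe2, f20, f21]; ring
  have heD : h (j e) D = 2 * s + 1 - 2 * q e := by
    rw [hxD, h_j, h_j, j_zero', j_one', B_self, hs]; ring
  have heD' : h (j e') D = 2 * q e' - (2 * s + 1) := by
    rw [hxD, h_j, h_j, j_zero', j_one', B_self, B_comm e' e, hs]; ring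
  have hD : h D D = -2 := by
    have : h D D = h f1 D + 2 * t * h f2 D + (h (j e) D - h (j e') D) := by
      rw [hxD D, h_f1', h_f2', h_symm D (j e), h_symm D (j e')]; ring
    rw [this, hf1D, hf2D, heD, heD']
    rw [q_sub] at ht
    linarith
  let g : V →ₗ[ℤ] V := LinearMap.id + (h.flip D).smulRight D
  have hg : ∀ x, g x = x + h x D • D := fun x => rfl
  refine Good.map g g (fun x y => by rw [hg, hg, refl_iso D hD])
    (fun v => by rw [hg, hg, refl_refl D hD]) ?_ ?_ H
  · rintro v ⟨a, b, w, rfl⟩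
    obtain ⟨m, hm⟩ : ∃ m, h (a • f1 + b • j e + (2:ℤ) • w) D = 2 * m - b := by
      refine ⟨a * t + b * (s + 1 - q e) + h w D, ?_⟩
      simp only [map_add, map_smul, LinearMap.add_apply, LinearMap.smul_apply, smul_eq_mul,
        hf1D, heD]
      ring
    refine ⟨a - b, b, w + m • D - (b * t) • f2, ?_⟩
    rw [hg, hm, hDdef]
    module
  · rintro v ⟨a, b, w, rfl⟩
    obtain ⟨m, hm⟩ : ∃ m, h (a • f1 + b • j e' + (2:ℤ) • w) D = 2 * m + b := by
      refine ⟨a * t + b * (- s - 1 + q e') + h w D, ?_⟩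
      simp only [map_add, map_smul, LinearMap.add_apply, LinearMap.smul_apply, smul_eq_mul,
        hf1D, heD']
      ring
    refine ⟨a + b, b, w + m • D + (b * t) • f2, ?_⟩
    rw [hg, hm, hDdef]
    module

def cands : List (Fin 8 → ℤ) :=
  [![0, 0, 0, 0, 0, 1, 0, 1], ![0, 0, 0, 0, 1, 1, 0, 1], ![0, 0, 1, 0, 1, 0, 0, 0],
   ![0, 0, 1, 1, 1, 1, 0, 1], ![0, 1, 1, 0, 0, 0, 0, 0], ![1, 0, 0, 0, 0, 1, 0, 0]]

lemma cands_prop : ∀ f ∈ cands, q f % 2 = 0 ∧ B e0 f % 2 = 1 := by decide +kernel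

def covP (x : Fin 8 → ZMod 2) : Bool :=
  !decide (q x = 0) || (cands.any fun k => decide (B x (fun n => (k n : ZMod 2)) = 1)) ||
    decide (x = 0)

lemma covP_all : ∀ a b c d e f g i : ZMod 2, covP ![a, b, c, d, e, f, g, i] = true := by
  decide +kernel

lemma cover (a b c d e f g i : ZMod 2) (h0 : q ![a, b, c, d, e, f, g, i] = 0) :
    (∃ k ∈ cands, B ![a, b, c, d, e, f, g, i] (fun n => (k n : ZMod 2)) = 1) ∨
    ![a, b, c, d, e, f, g, i] = 0 := by
  have := covP_all a b c d e f g i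
  simp only [covP, Bool.or_eq_true, List.any_eq_true, decide_eq_true_eq, h0, decide_true,
    Bool.not_true, Bool.false_eq_true, false_or] at this
  exact this

lemma good_sing (e : Fin 8 → ℤ) (he : ¬ Ev e) (hq : 2 ∣ q e) : Good (Nc e) := by
  have key := cover (e 0) (e 1) (e 2) (e 3) (e 4) (e 5) (e 6) (e 7) ?_
  · rcases key with ⟨k, hk, hB⟩ | h0
    · obtain ⟨hk1, hk2⟩ := cands_prop k hk
      have h1 : Good (Nc k) := step e0 k (by decide) (by omega) hk2 good_e0
      refine step k e (by omega) hq ?_ h1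
      rw [B_comm]
      have : ((B e k : ℤ) : ZMod 2) = ((1:ℤ) : ZMod 2) := by
        rw [Int.cast_one, ← hB]; simp [B]
      have := (ZMod.intCast_eq_intCast_iff' _ _ 2).1 this
      simpa using this
    · exfalso
      apply he
      refine ⟨fun i => e i / 2, ?_⟩
      have hh := fun i => congrFun h0 i
      have h0 := hh 0
      have h1 := hh 1
      have h2 := hh 2
      have h3 := hh 3
      have h4 := hh 4
      have h5 := hh 5
      have h6 := hh 6
      have h7 := hh 7
      simp at h0 h1 h2 h3 h4 h5 h6 h7
      rw [ZMod.intCast_zmod_eq_zero_iff_dvd _ 2] at h0 h1 h2 h3 h4 h5 h6 h7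
      ext i
      fin_cases i <;> simp <;> omega
  · have : ((q e : ℤ) : ZMod 2) = 0 := (ZMod.intCast_zmod_eq_zero_iff_dvd _ 2).2 (by exact_mod_cast hq)
    rw [← this]; simp [q]

lemma classify2 (N : AddSubgroup V) (two : ∀ w : V, (2:ℤ) • w ∈ N) (hf : f1 ∈ N)
    (even : ∀ v ∈ N, 2 ∣ v 1) (four : ∀ v ∈ N, 4 ∣ h v v)
    (dim : ∀ e e', j e ∈ N → j e' ∈ N → Ev e ∨ Ev e' ∨ Ev (e - e')) : Good (N : Set V) := by
  have hj : ∀ v ∈ N, j (ep v) ∈ N ∧ ∃ t : ℤ, v = v 0 • f1 + (2:ℤ) • (t • f2) + j (ep v) := by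
    intro v hv
    obtain ⟨t, ht⟩ := even v hv
    have hd := decomp v
    have h2 : v = v 0 • f1 + (2:ℤ) • (t • f2) + j (ep v) := by
      conv_lhs => rw [hd]
      rw [ht]; module
    refine ⟨?_, t, h2⟩
    have h3 : j (ep v) = v - v 0 • f1 - (2:ℤ) • (t • f2) := by
      rw [eq_sub_iff_add_eq, eq_sub_iff_add_eq]
      refine Eq.trans ?_ h2.symm
      abel
    rw [h3]
    exact N.sub_mem (N.sub_mem hv (N.zsmul_mem hf _)) (two _)
  by_cases hex : ∃ e, j e ∈ N ∧ ¬ Ev e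
  · obtain ⟨e, heN, he⟩ := hex
    have : (N : Set V) = Nc e := by
      ext v
      constructor
      · intro hv
        obtain ⟨hv1, t, ht⟩ := hj v hv
        rcases dim e (ep v) heN hv1 with h1 | ⟨w, hw⟩ | ⟨w, hw⟩
        · exact absurd h1 he
        · refine ⟨v 0, 0, t • f2 + j w, ?_⟩
          conv_lhs => rw [ht, hw, j_smul]
          module
        · refine ⟨v 0, 1, t • f2 - j w, ?_⟩
          have : ep v = e - (2:ℤ) • w := by rw [← hw]; abel
          conv_lhs => rw [ht, this, j_sub, j_smul]
          module
      · rintro ⟨a, b, w, rfl⟩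
        exact N.add_mem (N.add_mem (N.zsmul_mem hf _) (N.zsmul_mem heN _)) (two _)
    rw [this]
    refine good_sing e he ?_
    have := four _ heN
    rw [h_j, B_self] at this
    omega
  · push Not at hex
    have : (N : Set V) = Nc 0 := by
      ext v
      constructor
      · intro hv
        obtain ⟨hv1, t, ht⟩ := hj v hv
        obtain ⟨w, hw⟩ := hex _ hv1
        refine ⟨v 0, 0, t • f2 + j w, ?_⟩
        conv_lhs => rw [ht, hw, j_smul]
        module
      · rintro ⟨a, b, w, rfl⟩
        have j0 : j 0 = 0 := by decide
        rw [j0, smul_zero, add_zero]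
        exact N.add_mem (N.zsmul_mem hf _) (two _)
    rw [this]
    exact good_zero

structure Adm (N : AddSubgroup V) : Prop where
  two : ∀ w : V, (2:ℤ) • w ∈ N
  even : ∀ v ∈ N, ∀ w ∈ N, 2 ∣ h v w
  four : ∀ v ∈ N, 4 ∣ h v v
  prim : ∀ e, j e ∈ N → Ev e

lemma classify1 (N : AddSubgroup V) (hN : Adm N) (u : V) (hu : u ∈ N) (hodd : u 0 % 2 = 1) :
    Good (N : Set V) := by
  set e := ep u with he
  let c := j e
  have hcc : h c c = - (2 * q e) := by rw [h_j, B_self]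
  have h22 : h f2 f2 = 0 := by rw [h_f2]; rfl
  have hc2 : h c f2 = 0 := by rw [h_f2]; rfl
  have h2c : h f2 c = 0 := by rw [h_f2']; rfl
  let g : V →ₗ[ℤ] V := LinearMap.id + (h.flip f2).smulRight (q e • f2 + c)
    - (h.flip c).smulRight f2
  let g' : V →ₗ[ℤ] V := LinearMap.id + (h.flip f2).smulRight (q e • f2 - c)
    + (h.flip c).smulRight f2
  have hg : ∀ x, g x = x + h x f2 • (q e • f2 + c) - h x c • f2 := fun x => rfl
  have hg' : ∀ x, g' x = x + h x f2 • (q e • f2 - c) + h x c • f2 := fun x => rfl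
  have giso : ∀ x y, h (g x) (g y) = h x y := by
    intro x y
    simp only [hg, map_add, map_sub, map_smul, LinearMap.add_apply, LinearMap.sub_apply,
      LinearMap.smul_apply, smul_eq_mul, hcc, h22, hc2, h2c, h_symm f2 y, h_symm c y]
    ring
  have ggi : ∀ x, g (g' x) = x := by
    intro x
    simp only [hg, hg', map_add, map_sub, map_smul, LinearMap.add_apply, LinearMap.sub_apply,
      LinearMap.smul_apply, smul_eq_mul, hcc, h22, hc2, h2c]
    module
  have gf1 : g f1 = f1 + q e • f2 + c := by
    rw [hg, h_f2, h_f1']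
    have : c 1 = 0 := rfl
    have h1 : f1 0 = 1 := rfl
    rw [this, h1]; module
  have hgN : g f1 ∈ N := by
    have h4 := hN.four u hu
    rw [h_apply, B_self] at h4
    obtain ⟨s, hs⟩ : ∃ s, u 0 = 2 * s + 1 := ⟨u 0 / 2, by omega⟩
    have h5 : 2 ∣ q e - u 1 := by
      rw [← he, hs] at h4
      have e1 : (2 * s + 1) * u 1 + u 1 * (2 * s + 1) - 2 * q e = 4 * (s * u 1) + 2 * (u 1 - q e) := by
        ring
      rw [e1] at h4
      omega
    obtain ⟨t, ht⟩ := h5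
    have : g f1 = u + (2:ℤ) • (t • f2 - s • f1) := by
      rw [gf1]
      conv_rhs => rw [decomp u, ← he, hs, show u 1 = q e - 2 * t by omega]
      module
    rw [this]
    exact N.add_mem hu (hN.two _)
  refine Good.map (N' := (N.comap g.toAddMonoidHom : AddSubgroup V)) g g' giso ggi
    (fun v hv => hv) (fun v hv => ?_) (classify2 _ ?_ ?_ ?_ ?_ ?_)
  · change g (g' v) ∈ N
    rw [ggi]; exact hv
  · intro w
    change g ((2:ℤ) • w) ∈ N
    rw [map_smul]; exact hN.two _
  · exact hgN
  · intro v hv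
    have := hN.even _ hv _ hgN
    change 2 ∣ h (g v) (g f1) at this
    rwa [giso, h_f1] at this
  · intro v hv
    have := hN.four _ hv
    change 4 ∣ h (g v) (g v) at this
    rwa [giso] at this
  · have key : ∀ a, j a ∈ N.comap g.toAddMonoidHom → 2 ∣ B a e → Ev a := by
      intro a ha hb
      change g (j a) ∈ N at ha
      apply hN.prim
      obtain ⟨t, ht⟩ := hb
      have : j a = g (j a) - (2:ℤ) • (t • f2) := by
        rw [hg, h_f2, j_zero', h_j, ht]; module
      rw [this]
      exact N.sub_mem ha (hN.two _)
    intro a b ha hb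
    by_cases h1 : 2 ∣ B a e
    · exact Or.inl (key a ha h1)
    by_cases h2 : 2 ∣ B b e
    · exact Or.inr (Or.inl (key b hb h2))
    refine Or.inr (Or.inr (key _ ?_ ?_))
    · rw [j_sub]; exact AddSubgroup.sub_mem _ ha hb
    · rw [B_comm, B_sub_right, B_comm e a, B_comm e b]; omega

def sw : V →ₗ[ℤ] V := LinearMap.funLeft ℤ ℤ (Equiv.swap (0 : Fin 10) 1)

lemma sw0 (v : V) : sw v 0 = v 1 := rfl
lemma sw1 (v : V) : sw v 1 = v 0 := rfl
lemma ep_sw (v : V) : ep (sw v) = ep v := by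
  ext i; fin_cases i <;> rfl
lemma sw_sw (v : V) : sw (sw v) = v := by
  ext i; simp [sw, LinearMap.funLeft_apply]
lemma h_sw (x y : V) : h (sw x) (sw y) = h x y := by
  simp only [h_apply, sw0, sw1, ep_sw]; ring
lemma sw_j (e) : sw (j e) = j e := by
  rw [decomp (sw (j e)), ep_sw, sw0, sw1, ep_j, j_zero', j_one']; simp

lemma classify (N : AddSubgroup V) (hN : Adm N) : Good (N : Set V) := by
  by_cases h0 : ∃ u ∈ N, u 0 % 2 = 1
  · obtain ⟨u, hu, hodd⟩ := h0
    exact classify1 N hN u hu hodd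
  by_cases h1 : ∃ u ∈ N, u 1 % 2 = 1
  · obtain ⟨u, hu, hodd⟩ := h1
    refine Good.map (N' := (N.comap sw.toAddMonoidHom : AddSubgroup V)) sw sw h_sw sw_sw
      (fun v hv => hv) (fun v hv => ?_) (classify1 _ ?_ (sw u) ?_ ?_)
    · change sw (sw v) ∈ N
      rw [sw_sw]; exact hv
    · constructor
      · intro w
        change sw ((2:ℤ) • w) ∈ N
        rw [map_smul]; exact hN.two _
      · intro v hv w hw
        rw [← h_sw]; exact hN.even _ hv _ hw
      · intro v hv
        rw [← h_sw]; exact hN.four _ hv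
      · intro e he
        change sw (j e) ∈ N at he
        rw [sw_j] at he
        exact hN.prim e he
    · change sw (sw u) ∈ N
      rw [sw_sw]; exact hu
    · exact hodd
  push Not at h0 h1
  have : (N : Set V) = {v | ∃ w : V, v = (2:ℤ) • w} := by
    ext v
    constructor
    · intro hv
      obtain ⟨s, hs⟩ : ∃ s, v 0 = 2 * s := ⟨v 0 / 2, by have := h0 v hv; omega⟩
      obtain ⟨t, ht⟩ : ∃ s, v 1 = 2 * s := ⟨v 1 / 2, by have := h1 v hv; omega⟩
      have hd : v = (2:ℤ) • (s • f1 + t • f2) + j (ep v) := by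
        conv_lhs => rw [decomp v, hs, ht]
        module
      have hj : j (ep v) ∈ N := by
        have : j (ep v) = v - (2:ℤ) • (s • f1 + t • f2) := by
          rw [eq_sub_iff_add_eq, add_comm]; exact hd.symm
        rw [this]
        exact N.sub_mem hv (hN.two _)
      obtain ⟨w, hw⟩ := hN.prim _ hj
      refine ⟨s • f1 + t • f2 + j w, ?_⟩
      conv_lhs => rw [hd, hw, j_smul]
      module
    · rintro ⟨w, rfl⟩
      exact hN.two w
  rw [this]
  exact good_two

end OL

/-- Any even (nondegenerate) overlattice `M` of `U(2) ⊕ E₈(-2)` of rank `10` in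
which both summands `U(2)` and `E₈(-2)` embed primitively is isometric to one
of `U(2) ⊕ E₈(-2)`, `U ⊕ E₈(-2)` or `U(2) ⊕ D₄(-1) ⊕ D₄(-1)`.  Here `M` is
given by a Gram matrix `GM`, the embedding `ι` by a matrix `F`, and
`Fin.append v 0` (resp. `Fin.append 0 w`) denotes the vectors of
`U(2) ⊕ E₈(-2)` lying in the summand `U(2)` (resp. `E₈(-2)`). -/
theorem overlattice_of_U2E8_classification
    (GM : Matrix (Fin 10) (Fin 10) ℤ)
    (hsymm : GM.IsSymm)
    (hnondeg : GM.det ≠ 0)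
    (heven : ∀ v : Fin 10 → ℤ, (2 : ℤ) ∣ bform GM v v)
    (F : Matrix (Fin 10) (Fin 10) ℤ)
    (hinj : Function.Injective F.mulVec)
    (hiso : ∀ v w : Fin 10 → ℤ, bform GM (F *ᵥ v) (F *ᵥ w) = bform T1Mat v w)
    (hfinite : ∀ x : Fin 10 → ℤ, ∃ c : ℤ, c ≠ 0 ∧ ∃ v, c • x = F *ᵥ v)
    (hprimU : ∀ (x : Fin 10 → ℤ) (c : ℤ), c ≠ 0 →
      (∃ v : Fin 2 → ℤ, c • x = F *ᵥ Fin.append v (0 : Fin 8 → ℤ)) →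
      ∃ v : Fin 2 → ℤ, x = F *ᵥ Fin.append v (0 : Fin 8 → ℤ))
    (hprimE : ∀ (x : Fin 10 → ℤ) (c : ℤ), c ≠ 0 →
      (∃ w : Fin 8 → ℤ, c • x = F *ᵥ Fin.append (0 : Fin 2 → ℤ) w) →
      ∃ w : Fin 8 → ℤ, x = F *ᵥ Fin.append (0 : Fin 2 → ℤ) w) :
    ∃ P : Matrix (Fin 10) (Fin 10) ℤ,
      (∃ Q, P * Q = 1 ∧ Q * P = 1) ∧
      (Pᵀ * GM * P = T1Mat ∨ Pᵀ * GM * P = T2Mat ∨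
        Pᵀ * GM * P = dsum ((2 : ℤ) • UMat) (dsum (-D4Mat) (-D4Mat))) := by
  classical
  have hsm : ∀ (c : ℤ) (x y : Fin 10 → ℤ), bform GM (c • x) y = c * bform GM x y := by
    intro c x y; rw [bform, bform, smul_dotProduct, smul_eq_mul]
  have hsm' : ∀ (c : ℤ) (x y : Fin 10 → ℤ), bform GM x (c • y) = c * bform GM x y := by
    intro c x y; rw [bform, bform, Matrix.mulVec_smul, dotProduct_smul, smul_eq_mul]
  have cancel : ∀ (c : ℤ) (x y : Fin 10 → ℤ), c ≠ 0 → c • x = c • y → x = y := by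
    intro c x y hc hxy
    ext i
    have := congrFun hxy i
    simpa [hc] using this
  -- twice any vector lies in the image
  have half : ∀ x : Fin 10 → ℤ, ∃ v, F *ᵥ v = (2:ℤ) • x := by
    intro x
    obtain ⟨c, hc, v, hv⟩ := hfinite x
    have key : ∀ i, ∃ m, 2 * v i = c * m := by
      intro i
      refine ⟨bform GM x (F *ᵥ (OL.LMi *ᵥ Pi.single i 1)), ?_⟩
      rw [← hsm, hv, hiso, OL.bform_T1, OL.h_eq, bform, Matrix.mulVec_mulVec, OL.LM_LMi,
        Matrix.one_mulVec]
      simp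
    choose m hm using key
    refine ⟨m, cancel c _ _ hc ?_⟩
    rw [← Matrix.mulVec_smul, smul_comm, hv, ← Matrix.mulVec_smul]
    congr 1
    ext i
    simp [hm i]
  let N : AddSubgroup (Fin 10 → ℤ) :=
    { carrier := {v | ∃ x, F *ᵥ v = (2:ℤ) • x}
      zero_mem' := ⟨0, by simp⟩
      add_mem' := by
        rintro a b ⟨x, hx⟩ ⟨y, hy⟩
        exact ⟨x + y, by rw [Matrix.mulVec_add, hx, hy, smul_add]⟩
      neg_mem' := by
        rintro a ⟨x, hx⟩
        exact ⟨-x, by rw [Matrix.mulVec_neg, hx, smul_neg]⟩ }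
  have memN : ∀ v, v ∈ N ↔ ∃ x, F *ᵥ v = (2:ℤ) • x := fun v => Iff.rfl
  have hN : OL.Adm N := by
    constructor
    · intro w
      exact ⟨F *ᵥ w, by rw [Matrix.mulVec_smul]⟩
    · rintro v ⟨x, hx⟩ w ⟨y, hy⟩
      have h1 := hiso v w
      rw [hx, hy, hsm, hsm', OL.bform_T1] at h1
      omega
    · rintro v ⟨x, hx⟩
      have h1 := hiso v v
      rw [hx, hsm, hsm', OL.bform_T1] at h1
      have h2 := heven x
      omega
    · rintro e ⟨x, hx⟩
      obtain ⟨w, hw⟩ := hprimE x 2 two_ne_zero ⟨e, hx.symm⟩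
      refine ⟨w, ?_⟩
      rw [hw, ← Matrix.mulVec_smul] at hx
      have h1 := hinj hx
      change OL.j e = (2:ℤ) • OL.j w at h1
      rw [← OL.j_smul] at h1
      have h2 := congrArg OL.ep h1
      rwa [OL.ep_j, OL.ep_j] at h2
  obtain ⟨T, hT, φ, hφ, hφN⟩ := OL.classify N hN
  have hcol : ∀ k, ∃ x, F *ᵥ (φ k) = (2:ℤ) • x := fun k => (memN _).1 ((hφN _).2 ⟨k, rfl⟩)
  choose p hp using hcol
  let pl : (Fin 10 → ℤ) →ₗ[ℤ] (Fin 10 → ℤ) :=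
    { toFun := p
      map_add' := fun a b => cancel 2 _ _ two_ne_zero (by
        rw [smul_add, ← hp, ← hp, ← hp, map_add, Matrix.mulVec_add])
      map_smul' := fun c a => cancel 2 _ _ two_ne_zero (by
        rw [smul_comm, RingHom.id_apply, ← hp, ← hp, map_smul, Matrix.mulVec_smul]) }
  let P := LinearMap.toMatrix' pl
  have hP : ∀ k, P *ᵥ k = p k := fun k => by
    change LinearMap.toMatrix' pl *ᵥ k = p k
    rw [LinearMap.toMatrix'_mulVec]; rfl
  have hgram : Pᵀ * GM * P = T := by
    have hb : ∀ k l, bform (Pᵀ * GM * P) k l = bform T k l := by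
      intro k l
      rw [← OL.bform_mul, hP, hP]
      have h1 := hiso (φ k) (φ l)
      rw [hp, hp, hsm, hsm', OL.bform_T1, hφ] at h1
      omega
    ext i k
    have := hb (Pi.single i 1) (Pi.single k 1)
    simpa [bform] using this
  have hsurj : ∀ x, ∃ k, P *ᵥ k = x := by
    intro x
    obtain ⟨v, hv⟩ := half x
    obtain ⟨k, hk⟩ := (hφN v).1 ((memN v).2 ⟨x, hv⟩)
    refine ⟨k, cancel 2 _ _ two_ne_zero ?_⟩
    rw [hP, ← hp, ← hk, hv]
  choose s hs using hsurj
  let Q : Matrix (Fin 10) (Fin 10) ℤ := Matrix.of fun i k => s (Pi.single k 1) i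
  have hPQ : P * Q = 1 := by
    ext i k
    have := congrFun (hs (Pi.single k 1)) i
    rw [Matrix.one_apply]
    rw [Pi.single_apply] at this
    exact this
  refine ⟨P, ⟨Q, hPQ, mul_eq_one_comm.1 hPQ⟩, ?_⟩
  rw [hgram]
  exact hT
end
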